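/- Let X = {1,2,3}, let σ = (1 2 3) be the 3-cycle on X, and define r : X×X → X×X by r(x,y) = (σ(y), σ⁻¹(x)). Then (X,r) is a non-degenerate involutive solution of the Yang–Baxter equation which is a simple solution, is injective, and whose structure skew brace G_X is not a simple skew brace. -/

import Mathlib

/-!
Common definitions: skew braces, set-theoretic solutions of the Yang–Baxter
equation, structure skew braces, ideals, i-homomorphisms, solubility.
-/

universe u v

/-- A skew (left) brace: two group structures `(B,+)` and `(B,·)` sharing the
same identity `0`, with `a·(b+c) = a·b − a + a·c`. -/
structure SkewBrace (B : Type u) where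
  add : B → B → B
  zero : B
  neg : B → B
  mul : B → B → B
  inv : B → B
  add_assoc : ∀ a b c, add (add a b) c = add a (add b c)
  zero_add : ∀ a, add zero a = a
  add_zero : ∀ a, add a zero = a
  neg_add : ∀ a, add (neg a) a = zero
  add_neg : ∀ a, add a (neg a) = zero
  mul_assoc : ∀ a b c, mul (mul a b) c = mul a (mul b c)
  zero_mul : ∀ a, mul zero a = a
  mul_zero : ∀ a, mul a zero = a
  inv_mul : ∀ a, mul (inv a) a = zero
  mul_inv : ∀ a, mul a (inv a) = zero
  compat : ∀ a b c, mul a (add b c) = add (add (mul a b) (neg a)) (mul a c)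

namespace SkewBrace

variable {B : Type u} (S : SkewBrace B)

/-- `λ_a(b) = −a + a·b`. -/
def lam (a b : B) : B := S.add (S.neg a) (S.mul a b)

/-- `ρ_b(a) = λ_a(b)⁻¹ · a · b`. -/
def rho (b a : B) : B := S.mul (S.mul (S.inv (S.lam a b)) a) b

/-- The solution of the YBE associated with a skew brace:
`r_B(a,b) = (λ_a(b), ρ_b(a))`. -/
def rB : B × B → B × B := fun p => (S.lam p.1 p.2, S.rho p.2 p.1)

end SkewBrace

/-- Homomorphism of skew braces: preserves both operations. -/
def IsHom {B : Type u} {C : Type v} (S : SkewBrace B) (T : SkewBrace C) (f : B → C) : Prop :=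
  (∀ a b, f (S.add a b) = T.add (f a) (f b)) ∧ (∀ a b, f (S.mul a b) = T.mul (f a) (f b))

/-- The kernel of a skew brace homomorphism: preimage of `0`. -/
def brKer {B : Type u} {C : Type v} (T : SkewBrace C) (f : B → C) : Set B :=
  {a | f a = T.zero}

/-- An ideal of a skew brace: a sub-skew brace, normal in both `(B,+)` and `(B,·)`,
and `λ_b`-invariant for all `b`. -/
def IsIdeal {B : Type u} (S : SkewBrace B) (I : Set B) : Prop :=
  S.zero ∈ I ∧
  (∀ a ∈ I, ∀ b ∈ I, S.add a b ∈ I) ∧ (∀ a ∈ I, S.neg a ∈ I) ∧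
  (∀ a ∈ I, ∀ b ∈ I, S.mul a b ∈ I) ∧ (∀ a ∈ I, S.inv a ∈ I) ∧
  (∀ b : B, ∀ a ∈ I, S.add (S.add b a) (S.neg b) ∈ I) ∧
  (∀ b : B, ∀ a ∈ I, S.mul (S.mul b a) (S.inv b) ∈ I) ∧
  (∀ b : B, S.lam b '' I = I)

/-- A skew brace is simple if it is non-trivial and its only ideals are `{0}` and `B`. -/
def IsSimpleBrace {B : Type u} (S : SkewBrace B) : Prop :=
  (∃ a : B, a ≠ S.zero) ∧
  ∀ I : Set B, IsIdeal S I → I = {S.zero} ∨ I = Set.univ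

/-- The socle of a skew brace: elements `a` with `λ_a = id` commuting additively
with everything. -/
def Soc {B : Type u} (S : SkewBrace B) : Set B :=
  {a | (∀ b, S.lam a b = b) ∧ (∀ b, S.add a b = S.add b a)}

/-- `r × id` on triples. -/
def rOne {X : Type u} (r : X × X → X × X) : X × X × X → X × X × X :=
  fun p => ((r (p.1, p.2.1)).1, (r (p.1, p.2.1)).2, p.2.2)

/-- `id × r` on triples. -/
def rTwo {X : Type u} (r : X × X → X × X) : X × X × X → X × X × X :=
  fun p => (p.1, r p.2)

/-- `(X,r)` is a set-theoretic solution of the Yang–Baxter equation. -/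
def IsSolution {X : Type u} (r : X × X → X × X) : Prop :=
  Function.Bijective r ∧
  rOne r ∘ rTwo r ∘ rOne r = rTwo r ∘ rOne r ∘ rTwo r

/-- `λ_x(y)` for a solution, i.e. the first component of `r(x,y)`. -/
def lamMap {X : Type u} (r : X × X → X × X) (x : X) : X → X := fun y => (r (x, y)).1

/-- `ρ_y(x)` for a solution, i.e. the second component of `r(x,y)`. -/
def rhoMap {X : Type u} (r : X × X → X × X) (y : X) : X → X := fun x => (r (x, y)).2

/-- Non-degeneracy: all `λ_x` and `ρ_y` are bijective. -/
def Nondeg {X : Type u} (r : X × X → X × X) : Prop :=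
  (∀ x, Function.Bijective (lamMap r x)) ∧ (∀ y, Function.Bijective (rhoMap r y))

/-- Homomorphism of solutions: `(f×f)∘r = s∘(f×f)`. -/
def IsSolHom {X : Type u} {Y : Type v} (r : X × X → X × X) (s : Y × Y → Y × Y)
    (f : X → Y) : Prop :=
  Prod.map f f ∘ r = s ∘ Prod.map f f

/-- The structure skew brace `(G_X, ι)` of a solution `(X,r)`: the image of `ι`
generates `(G_X,·)`, `ι` intertwines `r` with `r_{G_X}`, and the pair has the
universal property for maps into skew braces. -/
structure StructureBrace {X : Type u} (r : X × X → X × X) where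
  G : Type u
  S : SkewBrace G
  ι : X → G
  gen : ∀ H : Set G, S.zero ∈ H → (∀ a ∈ H, ∀ b ∈ H, S.mul a b ∈ H) →
      (∀ a ∈ H, S.inv a ∈ H) → Set.range ι ⊆ H → H = Set.univ
  compat : Prod.map ι ι ∘ r = S.rB ∘ Prod.map ι ι
  univ : ∀ {C : Type u} (T : SkewBrace C) (g : X → C),
      Prod.map g g ∘ r = T.rB ∘ Prod.map g g →
      ∃! h : G → C, IsHom S T h ∧ h ∘ ι = g

/-- The multiplicative subgroup (as a set) generated by a subset. -/
def mulClosure {B : Type u} (S : SkewBrace B) (A : Set B) : Set B :=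
  ⋂₀ {H : Set B | S.zero ∈ H ∧ (∀ a ∈ H, ∀ b ∈ H, S.mul a b ∈ H) ∧
      (∀ a ∈ H, S.inv a ∈ H) ∧ A ⊆ H}

/-- The additive subgroup (as a set) generated by a subset. -/
def addClosure {B : Type u} (S : SkewBrace B) (A : Set B) : Set B :=
  ⋂₀ {H : Set B | S.zero ∈ H ∧ (∀ a ∈ H, ∀ b ∈ H, S.add a b ∈ H) ∧
      (∀ a ∈ H, S.neg a ∈ H) ∧ A ⊆ H}

/-- The ideal generated by a subset: intersection of all ideals containing it. -/
def idealClosure {B : Type u} (S : SkewBrace B) (A : Set B) : Set B :=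
  ⋂₀ {I : Set B | IsIdeal S I ∧ A ⊆ I}

/-- Product of two subsets in the multiplicative group. -/
def setMul {B : Type u} (S : SkewBrace B) (A₁ A₂ : Set B) : Set B :=
  {c | ∃ a ∈ A₁, ∃ b ∈ A₂, c = S.mul a b}

/-- Sum of two subsets in the additive group. -/
def setAdd {B : Type u} (S : SkewBrace B) (A₁ A₂ : Set B) : Set B :=
  {c | ∃ a ∈ A₁, ∃ b ∈ A₂, c = S.add a b}

/-- The multiplicative left coset `a·I`. -/
def lCoset {B : Type u} (S : SkewBrace B) (a : B) (I : Set B) : Set B :=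
  (fun w => S.mul a w) '' I

/-- Equivalence class of the kernel relation of a map. -/
def kerClass {X : Type u} {Y : Type v} (f : X → Y) (x : X) : Set X := {z | f z = f x}

/-- `X₀` is an i-kernel of the homomorphism of solutions `f : (X,r) → (Y,s)`:
`f` is a homomorphism of solutions, `X₀` is an equivalence class of `ker f`, and
for every class `Z` of `ker f`, `r(X₀ × Z) = Z × X₀` and `r(Z × X₀) = X₀ × Z`.
A homomorphism admitting such a class is an i-homomorphism. -/
def IsIKernel {X : Type u} {Y : Type v} (r : X × X → X × X) (s : Y × Y → Y × Y)
    (f : X → Y) (X₀ : Set X) : Prop :=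
  IsSolHom r s f ∧ (∃ x : X, X₀ = kerClass f x) ∧
  ∀ z : X, r '' (X₀ ×ˢ kerClass f z) = (kerClass f z) ×ˢ X₀ ∧
           r '' ((kerClass f z) ×ˢ X₀) = X₀ ×ˢ (kerClass f z)

/-- A strong left ideal: a `λ`-invariant subgroup of `(B,+)` which is normal
in `(B,+)`. -/
def IsStrongLeftIdeal {B : Type u} (S : SkewBrace B) (I : Set B) : Prop :=
  S.zero ∈ I ∧ (∀ a ∈ I, ∀ b ∈ I, S.add a b ∈ I) ∧ (∀ a ∈ I, S.neg a ∈ I) ∧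
  (∀ b : B, S.lam b '' I = I) ∧
  (∀ b : B, ∀ a ∈ I, S.add (S.add b a) (S.neg b) ∈ I)

/-- An abelian ideal: an ideal on which the two operations coincide and are
commutative (so it is an abelian/trivial skew brace). -/
def IsAbelianIdeal {C : Type u} (T : SkewBrace C) (J : Set C) : Prop :=
  IsIdeal T J ∧ ∀ a ∈ J, ∀ b ∈ J, T.mul a b = T.add a b ∧ T.add a b = T.add b a

/-- Solubility of a skew brace: epimorphisms `f_k : B → B_k`, `0 ≤ k ≤ t`, with
`Ker f_t = 0 ⊆ … ⊆ Ker f_0 = B` and `f_k(Ker f_{k−1})` an abelian ideal of `B_k`. -/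
def IsSoluble {B : Type u} (S : SkewBrace B) : Prop :=
  ∃ (t : ℕ) (C : Fin (t + 1) → Type u) (T : ∀ k, SkewBrace (C k)) (f : ∀ k, B → C k),
    (∀ k, IsHom S (T k) (f k) ∧ Function.Surjective (f k)) ∧
    brKer (T (Fin.last t)) (f (Fin.last t)) = {S.zero} ∧
    brKer (T 0) (f 0) = Set.univ ∧
    (∀ k : Fin t, brKer (T k.succ) (f k.succ) ⊆ brKer (T k.castSucc) (f k.castSucc)) ∧
    (∀ k : Fin t, IsAbelianIdeal (T k.succ) (f k.succ '' brKer (T k.castSucc) (f k.castSucc)))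

/-- Solubility of a solution `(X,r)` (with structure skew brace `(G_X, ι)`):
there are skew braces `B_0,…,B_t`, i-epimorphisms `f_k : (X,r) → (B_k, r_{B_k})`
with i-kernels `X_k` for `0 ≤ k ≤ t−1`, and an epimorphism `f_t`, such that
`ker f_k ⊆ ker f_{k−1}`, `ker f_0` is total, `ker f_t ⊆ ker ι`, and each
`f_k(X_{k−1})` lies in an abelian ideal `J` of `B_k` with `f_k(x)·J = f_k(y)·J`
whenever `x (ker f_{k−1}) y`. -/
def IsSolubleSolution {X : Type u} (r : X × X → X × X) (GX : StructureBrace r) : Prop :=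
  ∃ (t : ℕ) (C : Fin (t + 1) → Type u) (T : ∀ k, SkewBrace (C k))
    (f : ∀ k : Fin (t + 1), X → C k) (Xk : Fin t → Set X),
    (∀ k : Fin (t + 1), IsSolHom r (T k).rB (f k) ∧ Function.Surjective (f k)) ∧
    (∀ k : Fin t, IsIKernel r (T k.castSucc).rB (f k.castSucc) (Xk k)) ∧
    (∀ x y : X, f 0 x = f 0 y) ∧
    (∀ k : Fin t, ∀ x y : X, f k.succ x = f k.succ y → f k.castSucc x = f k.castSucc y) ∧
    (∀ x y : X, f (Fin.last t) x = f (Fin.last t) y → GX.ι x = GX.ι y) ∧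
    (∀ k : Fin t, ∃ J : Set (C k.succ), IsAbelianIdeal (T k.succ) J ∧
      f k.succ '' (Xk k) ⊆ J ∧
      ∀ x y : X, f k.castSucc x = f k.castSucc y →
        lCoset (T k.succ) (f k.succ x) J = lCoset (T k.succ) (f k.succ y) J)

/-- Decomposability of a solution: `X = Y ∪ Z` with `Y, Z` proper and
`r(Y×Y) = Y×Y`, `r(Z×Z) = Z×Z`. -/
def Decomposable {X : Type u} (r : X × X → X × X) : Prop :=
  ∃ Y Z : Set X, Y ≠ Set.univ ∧ Z ≠ Set.univ ∧ Y ∪ Z = Set.univ ∧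
    r '' (Y ×ˢ Y) = Y ×ˢ Y ∧ r '' (Z ×ˢ Z) = Z ×ˢ Z

/-- The Lyubashenko solution on `X = {1,2,3} ≃ Fin 3` given by
`r(x,y) = (σ(y), σ⁻¹(x))`, where `σ = (1 2 3)` is the 3-cycle (`σ(y) = y + 1`,
`σ⁻¹(x) = x + 2` in `Fin 3`). -/
def lyub : Fin 3 × Fin 3 → Fin 3 × Fin 3 := fun p => (p.2 + 1, p.1 + 2)

namespace SkewBrace

section

variable {B : Type u} (S : SkewBrace B)

lemma add_left_cancel {a b c : B} (h : S.add a b = S.add a c) : b = c := by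
  rw [← S.zero_add b, ← S.zero_add c, ← S.neg_add a, S.add_assoc, S.add_assoc, h]

lemma add_right_cancel {a b c : B} (h : S.add a c = S.add b c) : a = b := by
  rw [← S.add_zero a, ← S.add_zero b, ← S.add_neg c, ← S.add_assoc, ← S.add_assoc, h]

lemma mul_right_cancel {a b c : B} (h : S.mul a c = S.mul b c) : a = b := by
  rw [← S.mul_zero a, ← S.mul_zero b, ← S.mul_inv c, ← S.mul_assoc, ← S.mul_assoc, h]

lemma neg_zero : S.neg S.zero = S.zero := by
  rw [← S.add_zero (S.neg S.zero), S.neg_add]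

lemma inv_zero : S.inv S.zero = S.zero := by
  rw [← S.mul_zero (S.inv S.zero), S.inv_mul]

end

/-- The trivial skew brace on an additive group: both operations are the addition. -/
def trivialBrace (A : Type u) [AddGroup A] : SkewBrace A where
  add a b := a + b
  zero := 0
  neg a := -a
  mul a b := a + b
  inv a := -a
  add_assoc := _root_.add_assoc
  zero_add := _root_.zero_add
  add_zero := _root_.add_zero
  neg_add := neg_add_cancel
  add_neg := add_neg_cancel
  mul_assoc := _root_.add_assoc
  zero_mul := _root_.zero_add
  mul_zero := _root_.add_zero
  inv_mul := neg_add_cancel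
  mul_inv := add_neg_cancel
  compat a b c := by simp [_root_.add_assoc]

/-- The brace on `ZMod 9` with multiplication `a · b = a + b + 3ab`. -/
def zmodNine : SkewBrace (ZMod 9) where
  add a b := a + b
  zero := 0
  neg a := -a
  mul a b := a + b + 3 * a * b
  inv a := -a + 3 * a * a
  add_assoc := _root_.add_assoc
  zero_add := _root_.zero_add
  add_zero := _root_.add_zero
  neg_add := neg_add_cancel
  add_neg := add_neg_cancel
  mul_assoc a b c := by ring
  zero_mul a := by ring
  mul_zero a := by ring
  inv_mul := by decide
  mul_inv := by decide
  compat a b c := by ring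

end SkewBrace

section Homomorphisms

variable {B : Type u} {C : Type v} {S : SkewBrace B} {T : SkewBrace C} {f : B → C}

lemma IsHom.map_zero (hf : IsHom S T f) : f S.zero = T.zero := by
  apply T.add_left_cancel (a := f S.zero)
  rw [← hf.1, S.add_zero, T.add_zero]

lemma IsHom.map_neg (hf : IsHom S T f) (a : B) : f (S.neg a) = T.neg (f a) := by
  apply T.add_right_cancel (c := f a)
  rw [← hf.1, S.neg_add, T.neg_add, hf.map_zero]

lemma IsHom.map_inv (hf : IsHom S T f) (a : B) : f (S.inv a) = T.inv (f a) := by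
  apply T.mul_right_cancel (c := f a)
  rw [← hf.2, S.inv_mul, T.inv_mul, hf.map_zero]

/-- The kernel of a skew brace homomorphism is an ideal. -/
lemma IsHom.isIdeal_brKer (hf : IsHom S T f) : IsIdeal S (brKer T f) := by
  refine ⟨hf.map_zero, ?_, ?_, ?_, ?_, ?_, ?_, ?_⟩
  · intro a (ha : f a = _) b (hb : f b = _)
    change f _ = _
    rw [hf.1, ha, hb, T.zero_add]
  · intro a (ha : f a = _)
    change f _ = _
    rw [hf.map_neg, ha, T.neg_zero]
  · intro a (ha : f a = _) b (hb : f b = _)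
    change f _ = _
    rw [hf.2, ha, hb, T.zero_mul]
  · intro a (ha : f a = _)
    change f _ = _
    rw [hf.map_inv, ha, T.inv_zero]
  · intro b a (ha : f a = _)
    change f _ = _
    rw [hf.1, hf.1, hf.map_neg, ha, T.add_zero, T.add_neg]
  · intro b a (ha : f a = _)
    change f _ = _
    rw [hf.2, hf.2, hf.map_inv, ha, T.mul_zero, T.mul_inv]
  · intro b
    ext c
    constructor
    · rintro ⟨a, ha : f a = _, rfl⟩
      change f _ = _
      rw [SkewBrace.lam, hf.1, hf.2, hf.map_neg, ha, T.mul_zero, T.neg_add]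
    · intro (hc : f c = _)
      refine ⟨S.mul (S.inv b) (S.add b c), ?_, ?_⟩
      · change f _ = _
        rw [hf.2, hf.1, hf.map_inv, hc, T.add_zero, T.inv_mul]
      · rw [SkewBrace.lam, ← S.mul_assoc, S.mul_inv, S.zero_mul, ← S.add_assoc, S.neg_add,
          S.zero_add]

end Homomorphisms

/-- The embedding `i ↦ 1 + 3i` of `lyub` into the solution of the brace on `ZMod 9`. -/
def lyubToZModNine (i : Fin 3) : ZMod 9 := 1 + 3 * (i.val : ZMod 9)

lemma lyubToZModNine_injective : Function.Injective lyubToZModNine := by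
  unfold Function.Injective; decide

lemma isSolHom_lyubToZModNine : IsSolHom lyub SkewBrace.zmodNine.rB lyubToZModNine := by
  funext p
  revert p
  decide

lemma isSolHom_lyub_const : IsSolHom lyub (SkewBrace.trivialBrace (ZMod 2)).rB fun _ => 1 := by
  funext p
  revert p
  decide

lemma lyub_structureBrace_injective (GX : StructureBrace lyub) : Function.Injective GX.ι := by
  obtain ⟨h, ⟨-, hι⟩, -⟩ := GX.univ _ _ isSolHom_lyubToZModNine
  exact Function.Injective.of_comp (f := h) (hι ▸ lyubToZModNine_injective)

lemma lyub_structureBrace_not_simple (GX : StructureBrace lyub) : ¬ IsSimpleBrace GX.S := by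
  rintro ⟨-, hsimple⟩
  obtain ⟨h, ⟨hh, hι⟩, -⟩ := GX.univ _ _ isSolHom_lyub_const
  have hval (i : Fin 3) : h (GX.ι i) = 1 := congrFun hι i
  rcases hsimple _ hh.isIdeal_brKer with hI | hI
  · have hmem : GX.S.add (GX.S.neg (GX.ι 0)) (GX.ι 1) ∈
        brKer (SkewBrace.trivialBrace (ZMod 2)) h := by
      change h _ = _
      rw [hh.1, hh.map_neg, hval, hval]
      exact SkewBrace.neg_add _ _
    rw [hI, Set.mem_singleton_iff, ← GX.S.neg_add (GX.ι 0)] at hmem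
    exact absurd (lyub_structureBrace_injective GX (GX.S.add_left_cancel hmem)) (by decide)
  · have hmem : GX.ι 0 ∈ brKer (SkewBrace.trivialBrace (ZMod 2)) h := hI ▸ Set.mem_univ _
    have h_zero : h (GX.ι 0) = (0 : ZMod 2) := hmem
    rw [hval] at h_zero
    exact absurd h_zero (by decide)

lemma lyub_simple {Y : Type u} {s : Y × Y → Y × Y} {f : Fin 3 → Y} (hf : IsSolHom lyub s f)
    (hsurj : Function.Surjective f) :
    Function.Bijective f ∨ ∀ a b : Fin 3, f a = f b := by
  by_cases hinj : Function.Injective f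
  · exact Or.inl ⟨hinj, hsurj⟩
  · right
    have step (a b : Fin 3) (hab : f a = f b) : f (a + 1) = f (b + 1) := by
      have key (y : Fin 3) : f (y + 1) = (s (f 0, f y)).1 := congrArg Prod.fst (congrFun hf (0, y))
      rw [key, key, hab]
    simp only [Function.Injective, not_forall] at hinj
    obtain ⟨a, b, hab, hne⟩ := hinj
    have h_one := step _ _ hab
    have h_two := step _ _ h_one
    intro c d
    fin_cases a <;> fin_cases b <;> fin_cases c <;> fin_cases d <;> simp_all

/-- `lyub` is a non-degenerate involutive solution of the YBE which
is a simple solution, is injective, and whose structure skew brace is not a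
simple skew brace. -/
theorem stmt_6 :
    IsSolution lyub ∧ Nondeg lyub ∧ (lyub ∘ lyub = id) ∧
    (∀ (Y : Type) (s : Y × Y → Y × Y), IsSolution s → Nondeg s →
      ∀ f : Fin 3 → Y, IsSolHom lyub s f → Function.Surjective f →
        Function.Bijective f ∨ (∀ a b : Fin 3, f a = f b)) ∧
    (∀ GX : StructureBrace lyub, Function.Injective GX.ι ∧ ¬ IsSimpleBrace GX.S) := by
  refine ⟨⟨?_, ?_⟩, ⟨?_, ?_⟩, ?_, fun Y s _ _ f hf hsurj => lyub_simple hf hsurj,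
    fun GX => ⟨lyub_structureBrace_injective GX, lyub_structureBrace_not_simple GX⟩⟩
  · decide
  · decide
  · decide
  · decide
  · decide
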